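/- In the group G = F ⋊_φ ℤ/4 of Example 6.1, the subgroup H₁ (the image in G of the subgroup of F generated by x₀ and x₁) has width 2 (and hence height 2) in G: (a) there exist two elements g₁, g₂ of G lying in distinct cosets of H₁ such that the intersection g₁⁻¹H₁g₁ ∩ g₂⁻¹H₁g₂ is infinite; and (b) for any three elements g₁, g₂, g₃ of G lying in pairwise distinct cosets of H₁, there exist indices i ≠ j such that the intersection gᵢ⁻¹H₁gᵢ ∩ gⱼ⁻¹H₁gⱼ is finite. -/

import Mathlib

noncomputable section

/-- The free group on basis `{x_i : i ∈ ℤ/4}`. -/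
abbrev F : Type := FreeGroup (ZMod 4)

/-- The action of `ℤ/4` on `F` permuting the basis by `x_i ↦ x_{i+k}`. -/
def φ : Multiplicative (ZMod 4) →* MulAut F where
  toFun k := (FreeGroup.freeGroupCongr (Equiv.addRight (Multiplicative.toAdd k)) : F ≃* F)
  map_one' := by
    ext x
    simp
  map_mul' a b := by
    have h : (fun i : ZMod 4 => i + Multiplicative.toAdd (a * b)) =
        ((fun i : ZMod 4 => i + Multiplicative.toAdd a) ∘
          fun i : ZMod 4 => i + Multiplicative.toAdd b) := by
      funext i
      show i + (Multiplicative.toAdd a + Multiplicative.toAdd b) =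
        i + Multiplicative.toAdd b + Multiplicative.toAdd a
      abel
    ext x
    rw [MulAut.mul_apply]
    show FreeGroup.map _ x = FreeGroup.map _ (FreeGroup.map _ x)
    rw [FreeGroup.map.comp]
    exact congrArg (fun f => FreeGroup.map f x) h

/-- The group `G = F ⋊ ℤ/4` of Examples 6.1 and 6.2. -/
abbrev G : Type := F ⋊[φ] Multiplicative (ZMod 4)

/-- The conjugate subgroup `g⁻¹ H g = {g⁻¹ h g : h ∈ H}`. -/
def conjSub {G : Type*} [Group G] (g : G) (H : Subgroup G) : Subgroup G :=
  H.map (MulAut.conj g⁻¹).toMonoidHom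

/-- `a` lies in the double coset `H b H`. -/
def inDoubleCoset {G : Type*} [Group G] (H : Subgroup G) (a b : G) : Prop :=
  ∃ h₁ ∈ H, ∃ h₂ ∈ H, a = h₁ * b * h₂

/-- The subgroup `H₁ = ⟨x₀, x₁⟩` of Example 6.1, viewed inside `G`. -/
def H₁ : Subgroup G :=
  Subgroup.map (SemidirectProduct.inl : F →* G)
    (Subgroup.closure {FreeGroup.of (0 : ZMod 4), FreeGroup.of 1})

section FreeFactor

open FreeGroup

variable {α : Type*} {S : Set α}

theorem mk_singleton_mem_closure {p : α × Bool} (hp : p.1 ∈ S) :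
    FreeGroup.mk [p] ∈ Subgroup.closure (FreeGroup.of '' S) := by
  have h : FreeGroup.of p.1 ∈ Subgroup.closure (FreeGroup.of '' S) :=
    Subgroup.subset_closure ⟨_, hp, rfl⟩
  obtain ⟨x, _ | _⟩ := p
  · exact inv_mem h
  · exact h

theorem fst_mem_of_mem_toWord [DecidableEq α] {a : FreeGroup α}
    (ha : a ∈ Subgroup.closure (FreeGroup.of '' S)) : ∀ p ∈ a.toWord, p.1 ∈ S := by
  induction ha using Subgroup.closure_induction with
  | mem x hx =>
    obtain ⟨i, hi, rfl⟩ := hx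
    simpa using hi
  | one => simp
  | mul x y _ _ hx hy =>
    intro p hp
    rcases List.mem_append.1 ((toWord_mul_sublist x y).subset hp) with h | h
    · exact hx p h
    · exact hy p h
  | inv x _ hx =>
    intro p hp
    rw [toWord_inv, invRev] at hp
    simp only [List.mem_reverse, List.mem_map] at hp
    obtain ⟨q, hq, rfl⟩ := hp
    exact hx q hq

theorem toWord_mul_of_disjoint_ends [DecidableEq α] {x y : FreeGroup α}
    (h : ∀ p ∈ x.toWord.getLast?, ∀ q ∈ y.toWord.head?, p.1 ≠ q.1) :
    (x * y).toWord = x.toWord ++ y.toWord := by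
  rw [toWord_mul]
  refine IsReduced.reduce_eq (List.isChain_append.2 ⟨isReduced_toWord, isReduced_toWord, ?_⟩)
  exact fun p hp q hq e => absurd e (h p hp q hq)

/-- The subgroup generated by part of a basis of a free group is malnormal. -/
theorem mem_closure_of_mul_eq_mul {u a b : FreeGroup α}
    (ha : a ∈ Subgroup.closure (FreeGroup.of '' S))
    (hb : b ∈ Subgroup.closure (FreeGroup.of '' S)) (h : u * a = b * u) (ha1 : a ≠ 1) :
    u ∈ Subgroup.closure (FreeGroup.of '' S) := by
  classical
  induction hn : u.toWord.length using Nat.strong_induction_on generalizing u a b with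
  | _ n ih =>
    by_cases hhead : ∃ p ∈ u.toWord.head?, p.1 ∈ S
    · obtain ⟨p, hp, hpS⟩ := hhead
      obtain ⟨w, hw⟩ := List.head?_eq_some_iff.1 hp
      have hs := mk_singleton_mem_closure hpS
      have hu : u = FreeGroup.mk [p] * FreeGroup.mk w := by
        rw [mul_mk, List.singleton_append, ← hw, mk_toWord]
      rw [hu]
      refine mul_mem hs (ih _ ?_ (b := (FreeGroup.mk [p])⁻¹ * b * FreeGroup.mk [p]) ha
        (mul_mem (mul_mem (inv_mem hs) hb) hs) ?_ ha1 rfl)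
      · have : (FreeGroup.mk w).norm ≤ w.length := norm_mk_le
        rw [FreeGroup.norm] at this
        simp only [hw, List.length_cons] at hn
        omega
      · rw [hu] at h
        simp only [mul_assoc] at h ⊢
        rw [← h]
        group
    by_cases hlast : ∃ p ∈ u.toWord.getLast?, p.1 ∈ S
    · obtain ⟨p, hp, hpS⟩ := hlast
      obtain ⟨w, hw⟩ := List.getLast?_eq_some_iff.1 hp
      have hs := mk_singleton_mem_closure hpS
      have hu : u = FreeGroup.mk w * FreeGroup.mk [p] := by
        rw [mul_mk, ← hw, mk_toWord]
      rw [hu]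
      refine mul_mem (ih _ ?_ (a := FreeGroup.mk [p] * a * (FreeGroup.mk [p])⁻¹)
        (mul_mem (mul_mem hs ha) (inv_mem hs)) hb ?_ ?_ rfl) hs
      · have : (FreeGroup.mk w).norm ≤ w.length := norm_mk_le
        rw [FreeGroup.norm] at this
        simp only [hw, List.length_append, List.length_singleton] at hn
        omega
      · rw [hu] at h
        rw [← mul_assoc, ← mul_assoc, mul_inv_eq_iff_eq_mul, h, mul_assoc]
      · rwa [Ne, mul_inv_eq_one, mul_eq_left]
    push Not at hhead hlast
    have haS := fst_mem_of_mem_toWord ha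
    have hbS := fst_mem_of_mem_toWord hb
    have h₁ : (u * a).toWord = u.toWord ++ a.toWord :=
      toWord_mul_of_disjoint_ends fun p hp q hq e =>
        hlast p hp (e ▸ haS q (List.mem_of_head? hq))
    have h₂ : (b * u).toWord = b.toWord ++ u.toWord :=
      toWord_mul_of_disjoint_ends fun p hp q hq e =>
        hhead q hq (e ▸ hbS p (List.mem_of_getLast? hp))
    have hb1 : b ≠ 1 := by
      rintro rfl
      simp at h
      exact ha1 h
    rw [h, h₂] at h₁
    cases hu : u.toWord with
    | nil => rw [toWord_eq_nil_iff.1 hu]; exact one_mem _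
    | cons p w =>
      cases hbw : b.toWord with
      | nil => exact absurd (toWord_eq_nil_iff.1 hbw) hb1
      | cons q v =>
        rw [hu, hbw] at h₁
        obtain rfl : q = p := by simpa using congrArg List.head? h₁
        exact absurd (hbS q (by simp [hbw])) (hhead q (by simp [hu]))

/-- Conjugates of subgroups generated by disjoint parts of a basis of a free group meet
trivially. -/
theorem eq_one_of_mul_eq_mul_of_disjoint {T : Set α} (hST : Disjoint S T) {u a b : FreeGroup α}
    (ha : a ∈ Subgroup.closure (FreeGroup.of '' S))
    (hb : b ∈ Subgroup.closure (FreeGroup.of '' T)) (h : u * a = b * u) : a = 1 := by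
  classical
  let ρ : FreeGroup α →* FreeGroup α :=
    FreeGroup.lift fun i => if i ∈ S then FreeGroup.of i else 1
  have hρa : ρ a = a := by
    refine MonoidHom.eqOn_closure (f := ρ) (g := MonoidHom.id _) ?_ ha
    rintro _ ⟨i, hi, rfl⟩
    simp [ρ, hi]
  have hρb : ρ b = 1 := by
    refine MonoidHom.eqOn_closure (f := ρ) (g := 1) ?_ hb
    rintro _ ⟨i, hi, rfl⟩
    simp [ρ, Set.disjoint_right.1 hST hi]
  have := congrArg ρ h
  rwa [_root_.map_mul, _root_.map_mul, hρa, hρb, one_mul, mul_eq_left] at this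

end FreeFactor

theorem φ_of (k : Multiplicative (ZMod 4)) (i : ZMod 4) :
    φ k (FreeGroup.of i) = FreeGroup.of (i + k.toAdd) := by
  simp [φ]

theorem φ_mem_closure (k : Multiplicative (ZMod 4)) {S : Set (ZMod 4)} {a : F}
    (ha : a ∈ Subgroup.closure (FreeGroup.of '' S)) :
    φ k a ∈ Subgroup.closure (FreeGroup.of '' ((· + k.toAdd) '' S)) := by
  have h := Subgroup.mem_map_of_mem (φ k).toMonoidHom ha
  rw [MonoidHom.map_closure, Set.image_image] at h
  rw [Set.image_image]
  simpa [φ_of] using h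

theorem mem_H₁_iff {g : G} :
    g ∈ H₁ ↔ ∃ a ∈ Subgroup.closure (FreeGroup.of '' {(0 : ZMod 4), 1}),
      SemidirectProduct.inl a = g := by
  rw [H₁, Subgroup.mem_map, Set.image_pair]

theorem mem_conjSub_iff {G : Type*} [Group G] {g x : G} {H : Subgroup G} :
    x ∈ conjSub g H ↔ g * x * g⁻¹ ∈ H := by
  rw [conjSub, Subgroup.mem_map]
  constructor
  · rintro ⟨y, hy, rfl⟩
    simpa [mul_assoc] using hy
  · intro h
    exact ⟨_, h, by simp [mul_assoc]⟩

theorem inl_mul_left_eq {g : G} {a b : F}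
    (h : g * SemidirectProduct.inl a = SemidirectProduct.inl b * g) :
    g.left * φ g.right a = b * g.left := by
  simpa using congrArg SemidirectProduct.left h

theorem inf_conjSub_eq_bot {g₁ g₂ : G} (hg : g₂ * g₁⁻¹ ∉ H₁)
    (hk : (g₂ * g₁⁻¹).right = Multiplicative.ofAdd 0 ∨
      (g₂ * g₁⁻¹).right = Multiplicative.ofAdd 2) :
    conjSub g₁ H₁ ⊓ conjSub g₂ H₁ = ⊥ := by
  rw [eq_bot_iff]
  intro x hx
  rw [Subgroup.mem_inf, mem_conjSub_iff, mem_conjSub_iff, mem_H₁_iff, mem_H₁_iff] at hx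
  obtain ⟨⟨a, ha, hax⟩, b, hb, hbx⟩ := hx
  have key : g₂ * g₁⁻¹ * SemidirectProduct.inl a = SemidirectProduct.inl b * (g₂ * g₁⁻¹) := by
    rw [hax, hbx]
    group
  suffices a = 1 by
    subst this
    rw [map_one, eq_comm, mul_inv_eq_one, mul_eq_left] at hax
    exact Subgroup.mem_bot.2 hax
  generalize g₂ * g₁⁻¹ = g at hg hk key
  have h := inl_mul_left_eq key
  rcases hk with hk | hk
  · rw [hk, ofAdd_zero, map_one, MulAut.one_apply] at h
    by_contra ha1
    refine hg (mem_H₁_iff.2 ⟨g.left, mem_closure_of_mul_eq_mul ha hb h ha1, ?_⟩)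
    exact SemidirectProduct.ext rfl hk.symm
  · have hd : Disjoint ((· + g.right.toAdd) '' {(0 : ZMod 4), 1}) {(0 : ZMod 4), 1} := by
      rw [hk, Set.image_pair, Set.disjoint_left]
      simp only [Set.mem_insert_iff, Set.mem_singleton_iff, toAdd_ofAdd]
      decide
    have := eq_one_of_mul_eq_mul_of_disjoint hd (φ_mem_closure g.right ha) hb h
    simpa using this

theorem infinite_inf_conjSub :
    Infinite ↥(conjSub (1 : G) H₁ ⊓
      conjSub (SemidirectProduct.inr (Multiplicative.ofAdd 1) : G) H₁) := by
  have h0 : (SemidirectProduct.inl (FreeGroup.of 0) : G) ∈ conjSub (1 : G) H₁ ⊓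
      conjSub (SemidirectProduct.inr (Multiplicative.ofAdd 1) : G) H₁ := by
    rw [Subgroup.mem_inf, mem_conjSub_iff, mem_conjSub_iff, mem_H₁_iff, mem_H₁_iff]
    refine ⟨⟨_, Subgroup.subset_closure ⟨0, by simp, rfl⟩, by simp⟩,
      ⟨_, Subgroup.subset_closure ⟨1, by simp, rfl⟩, ?_⟩⟩
    rw [← map_inv, ← SemidirectProduct.inl_aut, φ_of]
    simp
  refine Infinite.of_injective (fun n : ℕ => ⟨_, pow_mem h0 n⟩) fun m n hmn => ?_
  have := SemidirectProduct.inl_injective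
    (by simpa only [← map_pow] using congrArg Subtype.val hmn)
  simpa using congrArg FreeGroup.norm this

theorem stmt15 :
    (∃ g₁ g₂ : G, g₂ * g₁⁻¹ ∉ H₁ ∧
      Infinite ↥(conjSub g₁ H₁ ⊓ conjSub g₂ H₁)) ∧
    (∀ g : Fin 3 → G,
      (∀ i j, i ≠ j → g j * (g i)⁻¹ ∉ H₁) →
      ∃ i j, i ≠ j ∧ Finite ↥(conjSub (g i) H₁ ⊓ conjSub (g j) H₁)) := by
  refine ⟨⟨1, SemidirectProduct.inr (Multiplicative.ofAdd 1), ?_, infinite_inf_conjSub⟩, ?_⟩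
  · rw [mem_H₁_iff]
    rintro ⟨a, -, h⟩
    have := congrArg SemidirectProduct.right h
    revert this
    simp
    decide
  · intro g hg
    have pigeon : ∀ k : Fin 3 → ZMod 4, ∃ i j, i ≠ j ∧ (k j - k i = 0 ∨ k j - k i = 2) := by
      decide
    obtain ⟨i, j, hij, h⟩ := pigeon fun i => (g i).right.toAdd
    refine ⟨i, j, hij, ?_⟩
    have hr : (g j * (g i)⁻¹).right =
        Multiplicative.ofAdd ((g j).right.toAdd - (g i).right.toAdd) := by
      rw [ofAdd_sub, ofAdd_toAdd, ofAdd_toAdd, div_eq_mul_inv, SemidirectProduct.mul_right,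
        SemidirectProduct.inv_right]
    rw [inf_conjSub_eq_bot (hg i j hij) (hr ▸ h.imp (congrArg _) (congrArg _))]
    infer_instance
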